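/- Let μ ≥ 0, let ω, k be positive natural numbers, let f(t) = (1/k)·sin(ωkt), and let h : ℝ → ℝ be any C^∞ 2π-periodic function. Then there exists K ∈ ℕ such that for every natural number k > K the equation ẍ + μẋ + (1 + f̈(t))·sin x + h(t)·cos x = 0 admits a 2π-periodic C^∞ solution x(t) with x(t) ∈ (π/2, 3π/2) for all t ∈ ℝ. -/

import Mathlib

open Real

open MeasureTheory Set Filter Topology

/-- Measurable functions on the line that are bounded. -/
def IsBoundedMeasurable (p : ℝ → ℝ) : Prop :=
  Measurable p ∧ ∃ C, ∀ t, |p t| ≤ C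

/-- The exponentially weighted average of the past of `p`; for bounded continuous `p` this is the
unique bounded solution of `w' + a w = p`. -/
noncomputable def pastAverage (a : ℝ) (p : ℝ → ℝ) (t : ℝ) : ℝ :=
  ∫ s in Ioi (0 : ℝ), exp (-a * s) * p (t - s)

/-- The exponentially weighted average of the future of `p`; for bounded continuous `p` this is the
unique bounded solution of `w' - a w = -p`. -/
noncomputable def futureAverage (a : ℝ) (p : ℝ → ℝ) (t : ℝ) : ℝ :=
  pastAverage a (fun s => p (-s)) (-t)

namespace IsBoundedMeasurable

variable {p q : ℝ → ℝ}

theorem const (c : ℝ) : IsBoundedMeasurable fun _ => c :=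
  ⟨measurable_const, |c|, fun _ => le_rfl⟩

theorem comp_neg (hp : IsBoundedMeasurable p) : IsBoundedMeasurable fun s => p (-s) :=
  ⟨hp.1.comp measurable_neg, hp.2.imp fun _ hC t => hC (-t)⟩

theorem add (hp : IsBoundedMeasurable p) (hq : IsBoundedMeasurable q) :
    IsBoundedMeasurable fun t => p t + q t := by
  obtain ⟨hp, C, hC⟩ := hp
  obtain ⟨hq, D, hD⟩ := hq
  exact ⟨hp.add hq, C + D, fun t => (abs_add_le _ _).trans (add_le_add (hC t) (hD t))⟩

theorem const_mul (hp : IsBoundedMeasurable p) (c : ℝ) :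
    IsBoundedMeasurable fun t => c * p t := by
  obtain ⟨hp, C, hC⟩ := hp
  refine ⟨hp.const_mul c, |c| * C, fun t => ?_⟩
  rw [abs_mul]
  exact mul_le_mul_of_nonneg_left (hC t) (abs_nonneg c)

theorem of_le_of_le {l u : ℝ → ℝ} (hp : Measurable p) (hl : IsBoundedMeasurable l)
    (hu : IsBoundedMeasurable u) (hlp : ∀ t, l t ≤ p t) (hpu : ∀ t, p t ≤ u t) :
    IsBoundedMeasurable p := by
  obtain ⟨-, C, hC⟩ := hl
  obtain ⟨-, D, hD⟩ := hu
  refine ⟨hp, max C D, fun t => abs_le.2 ⟨?_, ?_⟩⟩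
  · linarith [neg_le_of_abs_le (hC t), hlp t, le_max_left C D]
  · linarith [le_of_abs_le (hD t), hpu t, le_max_right C D]

theorem of_continuous_of_periodic {T : ℝ} (hT : T ≠ 0) (hp : Continuous p)
    (hper : Function.Periodic p T) : IsBoundedMeasurable p := by
  obtain ⟨C, hC⟩ := (hper.compact_of_continuous hT hp).isBounded.exists_norm_le
  exact ⟨hp.measurable, C, fun t => hC _ (mem_range_self t)⟩

theorem integrableOn_exp_mul (hp : IsBoundedMeasurable p) {a : ℝ} (ha : 0 < a) (t : ℝ) :
    IntegrableOn (fun s => exp (-a * s) * p (t - s)) (Ioi 0) := by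
  obtain ⟨hp, C, hC⟩ := hp
  exact (exp_neg_integrableOn_Ioi 0 ha).mul_bdd (c := C)
    (hp.comp (measurable_const.sub measurable_id)).aestronglyMeasurable
    (ae_of_all _ fun s => hC (t - s))

theorem integrableOn_Iic (hp : IsBoundedMeasurable p) {a : ℝ} (ha : 0 < a) (t : ℝ) :
    IntegrableOn (fun s => exp (a * s) * p s) (Iic t) := by
  obtain ⟨hp, C, hC⟩ := hp
  exact (integrableOn_exp_mul_Iic ha t).mul_bdd (c := C) hp.aestronglyMeasurable
    (ae_of_all _ hC)

theorem intervalIntegrable (hp : IsBoundedMeasurable p) {a : ℝ} (ha : 0 < a) (s t : ℝ) :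
    IntervalIntegrable (fun s => exp (a * s) * p s) volume s t :=
  ⟨(hp.integrableOn_Iic ha t).mono_set Ioc_subset_Iic_self,
    (hp.integrableOn_Iic ha s).mono_set Ioc_subset_Iic_self⟩

end IsBoundedMeasurable

section Averages

variable {a : ℝ} {p q : ℝ → ℝ}

theorem pastAverage_mono (ha : 0 < a) (hp : IsBoundedMeasurable p) (hq : IsBoundedMeasurable q)
    (hpq : ∀ t, p t ≤ q t) (t : ℝ) : pastAverage a p t ≤ pastAverage a q t :=
  setIntegral_mono (hp.integrableOn_exp_mul ha t) (hq.integrableOn_exp_mul ha t) fun s =>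
    mul_le_mul_of_nonneg_left (hpq (t - s)) (exp_pos _).le

theorem pastAverage_periodic {T : ℝ} (hp : Function.Periodic p T) :
    Function.Periodic (pastAverage a p) T := by
  intro t
  have hs : ∀ s, p (t + T - s) = p (t - s) := fun s => by
    rw [add_sub_right_comm, hp]
  simp only [pastAverage, hs]

theorem pastAverage_eq_of_hasDerivAt (ha : 0 < a) {v v' : ℝ → ℝ}
    (hv : ∀ t, HasDerivAt v (v' t) t) (hvb : IsBoundedMeasurable v)
    (hvb' : IsBoundedMeasurable v') (t : ℝ) :
    pastAverage a (fun t => v' t + a * v t) t = v t := by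
  have hd : ∀ s ∈ Ici (0 : ℝ), HasDerivAt (fun s => -(exp (-a * s) * v (t - s)))
      (exp (-a * s) * (v' (t - s) + a * v (t - s))) s := by
    intro s _
    have h1 : HasDerivAt (fun s => exp (-a * s)) (exp (-a * s) * (-a)) s := by
      simpa using ((hasDerivAt_id s).const_mul (-a)).exp
    refine (h1.mul ((hv (t - s)).comp_const_sub t s)).neg.congr_deriv ?_
    ring
  have hlim : Tendsto (fun s => -(exp (-a * s) * v (t - s))) atTop (𝓝 0) := by
    obtain ⟨-, C, hC⟩ := hvb
    have he : Tendsto (fun s => exp (-a * s) * C) atTop (𝓝 0) := by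
      have h1 : Tendsto (fun s => -a * s) atTop atBot :=
        tendsto_id.const_mul_atTop_of_neg (neg_lt_zero.2 ha)
      simpa using (tendsto_exp_atBot.comp h1).mul_const C
    refine squeeze_zero_norm (fun s => ?_) he
    rw [norm_neg, norm_mul, norm_of_nonneg (exp_pos _).le]
    exact mul_le_mul_of_nonneg_left (hC _) (exp_pos _).le
  have := integral_Ioi_of_hasDerivAt_of_tendsto' hd
    ((hvb'.add (hvb.const_mul a)).integrableOn_exp_mul ha t) hlim
  simpa [pastAverage] using this

theorem pastAverage_const (ha : 0 < a) (c t : ℝ) : pastAverage a (fun _ => c) t = c / a := by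
  have := pastAverage_eq_of_hasDerivAt ha (fun t => hasDerivAt_const t (c / a))
    (.const (c / a)) (.const 0) t
  simpa [mul_div_cancel₀ c ha.ne'] using this

theorem pastAverage_eq_integral (ha : 0 < a) (hp : IsBoundedMeasurable p) (t : ℝ) :
    pastAverage a p t = exp (-a * t) *
      ((∫ s in Iic (0 : ℝ), exp (a * s) * p s) + ∫ s in (0 : ℝ)..t, exp (a * s) * p s) := by
  have h1 := (Measure.measurePreserving_sub_left volume t).setIntegral_preimage_emb
    (MeasurableEquiv.subLeft t).measurableEmbedding
    (fun r => exp (-a * t) * (exp (a * r) * p r)) (Iio t)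
  have h2 : (fun s => t - s) ⁻¹' Iio t = Ioi 0 := by ext s; simp
  rw [← intervalIntegral.integral_Iic_sub_Iic (hp.integrableOn_Iic ha 0) (hp.integrableOn_Iic ha t),
    add_sub_cancel, integral_Iic_eq_integral_Iio, ← integral_const_mul, ← h1, h2, pastAverage]
  refine integral_congr_ae (ae_of_all _ fun s => ?_)
  simp only
  rw [← mul_assoc, ← exp_add]
  ring_nf

theorem continuous_pastAverage (ha : 0 < a) (hp : IsBoundedMeasurable p) :
    Continuous (pastAverage a p) := by
  rw [funext (pastAverage_eq_integral ha hp)]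
  have := intervalIntegral.continuous_primitive (hp.intervalIntegrable ha) 0
  fun_prop

theorem hasDerivAt_pastAverage (ha : 0 < a) (hp : IsBoundedMeasurable p) (hpc : Continuous p)
    (t : ℝ) : HasDerivAt (pastAverage a p) (p t - a * pastAverage a p t) t := by
  have hc : Continuous fun s => exp (a * s) * p s := by fun_prop
  have h1 : HasDerivAt (fun s => exp (-a * s)) (exp (-a * t) * (-a)) t := by
    simpa using ((hasDerivAt_id t).const_mul (-a)).exp
  have h2 := (hc.integral_hasStrictDerivAt 0 t).hasDerivAt.const_add
    (∫ s in Iic (0 : ℝ), exp (a * s) * p s)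
  have h3 : exp (-a * t) * exp (a * t) = 1 := by rw [← exp_add]; simp
  rw [pastAverage_eq_integral ha hp t, funext (pastAverage_eq_integral ha hp)]
  refine (h1.mul h2).congr_deriv ?_
  linear_combination p t * h3

theorem abs_pastAverage_le (ha : 0 < a) (hp : IsBoundedMeasurable p) {C : ℝ}
    (hC : ∀ t, |p t| ≤ C) (t : ℝ) : |pastAverage a p t| ≤ C / a := by
  refine abs_le.2 ⟨?_, ?_⟩
  · rw [← neg_div, ← pastAverage_const ha (-C) t]
    exact pastAverage_mono ha (.const _) hp (fun s => neg_le_of_abs_le (hC s)) t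
  · rw [← pastAverage_const ha C t]
    exact pastAverage_mono ha hp (.const _) (fun s => le_of_abs_le (hC s)) t

theorem isBoundedMeasurable_pastAverage (ha : 0 < a) (hp : IsBoundedMeasurable p) :
    IsBoundedMeasurable (pastAverage a p) :=
  ⟨(continuous_pastAverage ha hp).measurable,
    hp.2.elim fun C hC => ⟨C / a, abs_pastAverage_le ha hp hC⟩⟩

theorem tendsto_pastAverage (ha : 0 < a) {P : ℕ → ℝ → ℝ} (hP : ∀ n, Measurable (P n)) {C : ℝ}
    (hC : ∀ n t, |P n t| ≤ C) (hlim : ∀ t, Tendsto (fun n => P n t) atTop (𝓝 (p t))) (t : ℝ) :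
    Tendsto (fun n => pastAverage a (P n) t) atTop (𝓝 (pastAverage a p t)) := by
  refine tendsto_integral_of_dominated_convergence (fun s => exp (-a * s) * C) (fun n => ?_)
    ((exp_neg_integrableOn_Ioi 0 ha).mul_const C) (fun n => ae_of_all _ fun s => ?_)
    (ae_of_all _ fun s => (hlim (t - s)).const_mul _)
  · have := hP n
    exact Measurable.aestronglyMeasurable (by fun_prop)
  · rw [norm_mul, norm_of_nonneg (exp_pos _).le]
    exact mul_le_mul_of_nonneg_left (hC n _) (exp_pos _).le

theorem futureAverage_mono (ha : 0 < a) (hp : IsBoundedMeasurable p) (hq : IsBoundedMeasurable q)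
    (hpq : ∀ t, p t ≤ q t) (t : ℝ) : futureAverage a p t ≤ futureAverage a q t :=
  pastAverage_mono ha hp.comp_neg hq.comp_neg (fun s => hpq (-s)) (-t)

theorem futureAverage_periodic {T : ℝ} (hp : Function.Periodic p T) :
    Function.Periodic (futureAverage a p) T := by
  have hneg : Function.Periodic (fun s => p (-s)) T := fun s => by
    simp only [neg_add, ← sub_eq_add_neg, hp.sub_eq]
  intro t
  simp only [futureAverage, neg_add, ← sub_eq_add_neg]
  exact (pastAverage_periodic hneg).sub_eq (-t)

theorem futureAverage_eq_of_hasDerivAt (ha : 0 < a) {v v' : ℝ → ℝ}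
    (hv : ∀ t, HasDerivAt v (v' t) t) (hvb : IsBoundedMeasurable v)
    (hvb' : IsBoundedMeasurable v') (t : ℝ) :
    futureAverage a (fun t => a * v t - v' t) t = v t := by
  have hd : ∀ s, HasDerivAt (fun s => v (-s)) (-1 * v' (-s)) s := fun s =>
    (hv (-s)).scomp s (hasDerivAt_neg s)
  have := pastAverage_eq_of_hasDerivAt ha hd hvb.comp_neg (hvb'.comp_neg.const_mul (-1)) (-t)
  simpa [futureAverage, add_comm, sub_eq_add_neg] using this

theorem hasDerivAt_futureAverage (ha : 0 < a) (hp : IsBoundedMeasurable p) (hpc : Continuous p)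
    (t : ℝ) : HasDerivAt (futureAverage a p) (a * futureAverage a p t - p t) t := by
  have := (hasDerivAt_pastAverage ha hp.comp_neg (hpc.comp continuous_neg) (-t)).scomp t
    (hasDerivAt_neg t)
  refine this.congr_deriv ?_
  simp [futureAverage]

theorem isBoundedMeasurable_futureAverage (ha : 0 < a) (hp : IsBoundedMeasurable p) :
    IsBoundedMeasurable (futureAverage a p) :=
  (isBoundedMeasurable_pastAverage ha hp.comp_neg).comp_neg

theorem tendsto_futureAverage (ha : 0 < a) {P : ℕ → ℝ → ℝ} (hP : ∀ n, Measurable (P n)) {C : ℝ}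
    (hC : ∀ n t, |P n t| ≤ C) (hlim : ∀ t, Tendsto (fun n => P n t) atTop (𝓝 (p t))) (t : ℝ) :
    Tendsto (fun n => futureAverage a (P n) t) atTop (𝓝 (futureAverage a p t)) :=
  tendsto_pastAverage ha (fun n => (hP n).comp measurable_neg) (fun n s => hC n (-s))
    (fun s => hlim (-s)) (-t)

end Averages

section PeriodicBoundaryValueProblem

theorem Function.Periodic.deriv_of_real {f : ℝ → ℝ} {T : ℝ} (hf : Function.Periodic f T) :
    Function.Periodic (deriv f) T := fun t => by
  rw [← deriv_comp_add_const, funext hf]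

theorem futureAverage_pastAverage_eq_of_contDiff {a b T : ℝ} (ha : 0 < a) (hb : 0 < b)
    (hT : T ≠ 0) {v : ℝ → ℝ} (hv : ContDiff ℝ 2 v) (hper : Function.Periodic v T) (t : ℝ) :
    futureAverage b (pastAverage a fun t =>
      a * b * v t - (a - b) * deriv v t - deriv (deriv v) t) t = v t := by
  obtain ⟨hd, -, hv1⟩ := contDiff_succ_iff_deriv.1 (show ContDiff ℝ (1 + 1) v from hv)
  obtain ⟨hd', hv2⟩ := contDiff_one_iff_deriv.1 hv1
  have hvb := IsBoundedMeasurable.of_continuous_of_periodic hT hv.continuous hper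
  have hvb' := IsBoundedMeasurable.of_continuous_of_periodic hT hv1.continuous hper.deriv_of_real
  have hvb'' :=
    IsBoundedMeasurable.of_continuous_of_periodic hT hv2 hper.deriv_of_real.deriv_of_real
  have hpast := pastAverage_eq_of_hasDerivAt ha
    (v := fun t => b * v t + -1 * deriv v t) (v' := fun t => b * deriv v t + -1 * deriv (deriv v) t)
    (fun t => ((hd t).hasDerivAt.const_mul b).add ((hd' t).hasDerivAt.const_mul (-1)))
    ((hvb.const_mul b).add (hvb'.const_mul (-1))) ((hvb'.const_mul b).add (hvb''.const_mul (-1)))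
  have hfut := futureAverage_eq_of_hasDerivAt hb (fun t => (hd t).hasDerivAt) hvb hvb' t
  rw [← hfut]
  congr 1
  ext s
  rw [show b * v s - deriv v s = b * v s + -1 * deriv v s by ring, ← hpast s]
  congr 1
  ext r
  ring

/-- Monotone iteration between a lower solution `α` and an upper solution `β` of
`u'' + μ u' + g(t, u) = 0`. -/
theorem exists_periodic_solution_between {T μ Λ : ℝ} (hT : T ≠ 0) (hμ : 0 ≤ μ)
    {g : ℝ → ℝ → ℝ} (hg : Continuous fun z : ℝ × ℝ => g z.1 z.2)
    (hgT : ∀ x, Function.Periodic (fun t => g t x) T)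
    (hgΛ : ∀ t, Monotone fun x => g t x + Λ * x)
    {α β : ℝ → ℝ} (hα : ContDiff ℝ 2 α) (hβ : ContDiff ℝ 2 β)
    (hαT : Function.Periodic α T) (hβT : Function.Periodic β T) (hαβ : ∀ t, α t ≤ β t)
    (hαg : ∀ t, 0 ≤ deriv (deriv α) t + μ * deriv α t + g t (α t))
    (hβg : ∀ t, deriv (deriv β) t + μ * deriv β t + g t (β t) ≤ 0) :
    ∃ u v : ℝ → ℝ, Function.Periodic u T ∧ (∀ t, α t ≤ u t ∧ u t ≤ β t) ∧
      (∀ t, HasDerivAt u (v t) t) ∧ ∀ t, HasDerivAt v (-(μ * v t) - g t (u t)) t := by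
  obtain ⟨b, hb, hbΛ⟩ : ∃ b : ℝ, 0 < b ∧ Λ ≤ (b + μ) * b := by
    refine ⟨max Λ 1, by positivity, ?_⟩
    nlinarith [le_max_left Λ 1, le_max_right Λ 1,
      mul_nonneg hμ (zero_le_one.trans (le_max_right Λ 1))]
  set a := b + μ with ha_def
  have ha : 0 < a := by positivity
  set q : (ℝ → ℝ) → ℝ → ℝ := fun u t => g t (u t) + a * b * u t with hq
  let S : (ℝ → ℝ) → ℝ → ℝ := fun u => futureAverage b (pastAverage a (q u))
  have hq_mono : ∀ {u v : ℝ → ℝ} t, u t ≤ v t → q u t ≤ q v t := fun {u v} t huv => by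
    have := hgΛ t huv
    simp only [hq] at this ⊢
    nlinarith [mul_le_mul_of_nonneg_right hbΛ (sub_nonneg.2 huv)]
  have hq_meas : ∀ {u : ℝ → ℝ}, Measurable u → Measurable (q u) := fun {u} hu =>
    (hg.measurable.comp (measurable_id.prodMk hu)).add (hu.const_mul _)
  have hq_cont : ∀ {u : ℝ → ℝ}, Continuous u → Continuous (q u) := fun {u} hu =>
    (hg.comp (continuous_id.prodMk hu)).add (hu.const_mul _)
  have hq_per : ∀ {u : ℝ → ℝ}, Function.Periodic u T → Function.Periodic (q u) T :=
    fun {u} hu t => by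
      have := hgT (u t) t
      simp only [hq, hu t] at this ⊢
      rw [this]
  have hqα := IsBoundedMeasurable.of_continuous_of_periodic hT (hq_cont hα.continuous) (hq_per hαT)
  have hqβ := IsBoundedMeasurable.of_continuous_of_periodic hT (hq_cont hβ.continuous) (hq_per hβT)
  have hq_bdd : ∀ {u : ℝ → ℝ}, Measurable u → (∀ t, α t ≤ u t ∧ u t ≤ β t) →
      IsBoundedMeasurable (q u) := fun hu h =>
    .of_le_of_le (hq_meas hu) hqα hqβ (fun t => hq_mono t (h t).1) (fun t => hq_mono t (h t).2)
  have hG_mono : ∀ {p r : ℝ → ℝ}, IsBoundedMeasurable p → IsBoundedMeasurable r →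
      (∀ t, p t ≤ r t) → ∀ t, futureAverage b (pastAverage a p) t ≤
        futureAverage b (pastAverage a r) t := fun hp hr h =>
    futureAverage_mono hb (isBoundedMeasurable_pastAverage ha hp)
      (isBoundedMeasurable_pastAverage ha hr) (pastAverage_mono ha hp hr h)
  have hlin : ∀ {v : ℝ → ℝ}, ContDiff ℝ 2 v → Function.Periodic v T → IsBoundedMeasurable
      fun t => a * b * v t - (a - b) * deriv v t - deriv (deriv v) t := fun {v} hv hper => by
    have h1 := (contDiff_succ_iff_deriv.1 (show ContDiff ℝ (1 + 1) v from hv)).2.2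
    have h2 := (contDiff_one_iff_deriv.1 h1).2
    have h3 := h1.continuous
    have h4 := hv.continuous
    refine .of_continuous_of_periodic hT (by fun_prop) fun t => ?_
    simp only [hper t, hper.deriv_of_real t, hper.deriv_of_real.deriv_of_real t]
  have hαS : ∀ t, α t ≤ S α t := fun t => by
    rw [← futureAverage_pastAverage_eq_of_contDiff ha hb hT hα hαT t]
    refine hG_mono (hlin hα hαT) hqα (fun t => ?_) t
    have := hαg t
    simp only [hq, ha_def]
    linarith
  have hSβ : ∀ t, S β t ≤ β t := fun t => by
    conv_rhs => rw [← futureAverage_pastAverage_eq_of_contDiff ha hb hT hβ hβT t]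
    refine hG_mono hqβ (hlin hβ hβT) (fun t => ?_) t
    have := hβg t
    simp only [hq, ha_def]
    linarith
  let U : ℕ → ℝ → ℝ := fun n => S^[n] α
  have hU_succ : ∀ n, U (n + 1) = S (U n) := fun n => Function.iterate_succ_apply' S n α
  have hU : ∀ n, Measurable (U n) ∧ Function.Periodic (U n) T ∧ ∀ t, α t ≤ U n t ∧ U n t ≤ β t := by
    intro n
    induction n with
    | zero => exact ⟨hα.continuous.measurable, hαT, fun t => ⟨le_rfl, hαβ t⟩⟩
    | succ n ih =>
      obtain ⟨hm, hp, hb'⟩ := ih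
      have hqb := hq_bdd hm hb'
      rw [hU_succ]
      refine ⟨(isBoundedMeasurable_futureAverage hb (isBoundedMeasurable_pastAverage ha hqb)).1,
        futureAverage_periodic (pastAverage_periodic (hq_per hp)), fun t => ⟨?_, ?_⟩⟩
      · exact (hαS t).trans (hG_mono hqα hqb (fun s => hq_mono s (hb' s).1) t)
      · exact (hG_mono hqb hqβ (fun s => hq_mono s (hb' s).2) t).trans (hSβ t)
  have hU_le : ∀ n t, U n t ≤ U (n + 1) t := by
    intro n
    induction n with
    | zero => exact hαS
    | succ n ih =>
      intro t
      rw [hU_succ n, hU_succ (n + 1)]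
      exact hG_mono (hq_bdd (hU n).1 (hU n).2.2) (hq_bdd (hU (n + 1)).1 (hU (n + 1)).2.2)
        (fun s => hq_mono s (ih s)) t
  have hlim : ∀ t, ∃ l, Tendsto (fun n => U n t) atTop (𝓝 l) := fun t =>
    ⟨_, tendsto_atTop_ciSup (monotone_nat_of_le_succ fun n => hU_le n t)
      ⟨β t, forall_mem_range.2 fun n => ((hU n).2.2 t).2⟩⟩
  choose u hu using hlim
  have hu_meas : Measurable u :=
    measurable_of_tendsto_metrizable (fun n => (hU n).1) (tendsto_pi_nhds.2 hu)
  have hu_bdd : ∀ t, α t ≤ u t ∧ u t ≤ β t := fun t =>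
    ⟨ge_of_tendsto' (hu t) fun n => ((hU n).2.2 t).1,
      le_of_tendsto' (hu t) fun n => ((hU n).2.2 t).2⟩
  have hu_per : Function.Periodic u T := fun t =>
    tendsto_nhds_unique (hu (t + T)) (by simpa only [(hU _).2.1 t] using hu t)
  obtain ⟨C, hC⟩ : ∃ C, ∀ n t, |q (U n) t| ≤ C := by
    obtain ⟨-, C, hC⟩ := hqα
    obtain ⟨-, D, hD⟩ := hqβ
    refine ⟨max C D, fun n t => abs_le.2 ⟨?_, ?_⟩⟩
    · linarith [neg_le_of_abs_le (hC t), hq_mono t ((hU n).2.2 t).1, le_max_left C D]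
    · linarith [le_of_abs_le (hD t), hq_mono t ((hU n).2.2 t).2, le_max_right C D]
  have hqb := hq_bdd hu_meas hu_bdd
  set w := pastAverage a (q u)
  have hwb : IsBoundedMeasurable w := isBoundedMeasurable_pastAverage ha hqb
  have hq_lim : ∀ t, Tendsto (fun n => q (U n) t) atTop (𝓝 (q u t)) := fun t =>
    ((hg.tendsto (t, u t)).comp (tendsto_const_nhds.prodMk_nhds (hu t))).add ((hu t).const_mul _)
  have hw_lim : ∀ t, Tendsto (fun n => pastAverage a (q (U n)) t) atTop (𝓝 (w t)) :=
    tendsto_pastAverage ha (fun n => hq_meas (hU n).1) hC hq_lim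
  have hu_fix : u = futureAverage b w := funext fun t => by
    refine tendsto_nhds_unique ((tendsto_add_atTop_iff_nat 1).2 (hu t)) ?_
    simp only [hU_succ]
    exact tendsto_futureAverage hb (fun n => (isBoundedMeasurable_pastAverage ha
      (hq_bdd (hU n).1 (hU n).2.2)).1)
      (fun n => abs_pastAverage_le ha (hq_bdd (hU n).1 (hU n).2.2) (hC n)) hw_lim t
  have hu_deriv : ∀ t, HasDerivAt u (b * u t - w t) t := fun t => by
    have := hasDerivAt_futureAverage hb hwb (continuous_pastAverage ha hqb) t
    rwa [← hu_fix] at this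
  have hu_cont : Continuous u := continuous_iff_continuousAt.2 fun t => (hu_deriv t).continuousAt
  refine ⟨u, fun t => b * u t - w t, hu_per, hu_bdd, hu_deriv, fun t => ?_⟩
  refine (((hu_deriv t).const_mul b).sub
    (hasDerivAt_pastAverage ha hqb (hq_cont hu_cont) t)).congr_deriv ?_
  simp only [hq, ha_def]
  ring

theorem contDiff_of_hasDerivAt_of_hasDerivAt {u v : ℝ → ℝ} {F : ℝ → ℝ → ℝ → ℝ}
    (hF : ContDiff ℝ (⊤ : ℕ∞) fun z : ℝ × ℝ × ℝ => F z.1 z.2.1 z.2.2)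
    (hu : ∀ t, HasDerivAt u (v t) t) (hv : ∀ t, HasDerivAt v (F t (u t) (v t)) t) :
    ContDiff ℝ (⊤ : ℕ∞) u := by
  have key : ∀ n : ℕ, ContDiff ℝ n u ∧ ContDiff ℝ n v := by
    intro n
    induction n with
    | zero =>
      exact ⟨contDiff_zero.2 (continuous_iff_continuousAt.2 fun t => (hu t).continuousAt),
        contDiff_zero.2 (continuous_iff_continuousAt.2 fun t => (hv t).continuousAt)⟩
    | succ n ih =>
      have hFn : ContDiff ℝ n fun t => F t (u t) (v t) :=
        (hF.of_le (by exact_mod_cast le_top)).comp (contDiff_id.prodMk (ih.1.prodMk ih.2))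
      push_cast
      simp only [contDiff_succ_iff_deriv]
      refine ⟨⟨fun t => (hu t).differentiableAt, by simp, ?_⟩,
        ⟨fun t => (hv t).differentiableAt, by simp, ?_⟩⟩
      · rw [funext fun t => (hu t).deriv]
        exact ih.2
      · rw [funext fun t => (hv t).deriv]
        exact hFn
  exact contDiff_infty.2 fun n => (key n).1

end PeriodicBoundaryValueProblem

section KapitzaWhitney

/-- Displacement from the horizontal that absorbs the fast pivot acceleration
`(1/k) sin(ωkt)''`. -/
noncomputable def pivotCorrection (μ ω k t : ℝ) : ℝ :=
  2 / k - 1 / k * sin (ω * k * t) - μ / (ω * k ^ 2) * cos (ω * k * t)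

variable {μ ω k : ℝ}

theorem hasDerivAt_sin_const_mul (c t : ℝ) :
    HasDerivAt (fun t => sin (c * t)) (c * cos (c * t)) t :=
  (((hasDerivAt_id t).const_mul c).sin).congr_deriv (by simp [mul_comm])

theorem hasDerivAt_cos_const_mul (c t : ℝ) :
    HasDerivAt (fun t => cos (c * t)) (-(c * sin (c * t))) t :=
  (((hasDerivAt_id t).const_mul c).cos).congr_deriv (by simp [mul_comm])

theorem deriv_deriv_pivot (hk : k ≠ 0) :
    deriv (deriv fun s => 1 / k * sin (ω * k * s)) = fun t => -(ω ^ 2 * k * sin (ω * k * t)) := by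
  have h1 : (deriv fun s => 1 / k * sin (ω * k * s)) = fun t => ω * cos (ω * k * t) :=
    funext fun t => (((hasDerivAt_sin_const_mul (ω * k) t).const_mul (1 / k)).congr_deriv
      (by field_simp)).deriv
  rw [h1]
  exact funext fun t => (((hasDerivAt_cos_const_mul (ω * k) t).const_mul ω).congr_deriv
    (by ring)).deriv

theorem deriv_pivotCorrection (hω : ω ≠ 0) (hk : k ≠ 0) :
    deriv (pivotCorrection μ ω k) =
      fun t => -(ω * cos (ω * k * t)) + μ / k * sin (ω * k * t) :=
  funext fun t => ((((hasDerivAt_sin_const_mul (ω * k) t).const_mul (1 / k)).const_sub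
    (2 / k)).sub ((hasDerivAt_cos_const_mul (ω * k) t).const_mul (μ / (ω * k ^ 2)))).congr_deriv
      (by field_simp; ring) |>.deriv

theorem deriv_deriv_pivotCorrection (hω : ω ≠ 0) (hk : k ≠ 0) :
    deriv (deriv (pivotCorrection μ ω k)) =
      fun t => ω ^ 2 * k * sin (ω * k * t) + μ * ω * cos (ω * k * t) := by
  rw [deriv_pivotCorrection hω hk]
  exact funext fun t => ((((hasDerivAt_cos_const_mul (ω * k) t).const_mul ω).neg).add
    ((hasDerivAt_sin_const_mul (ω * k) t).const_mul (μ / k))).congr_deriv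
      (by field_simp) |>.deriv

theorem contDiff_pivotCorrection {n : WithTop ℕ∞} : ContDiff ℝ n (pivotCorrection μ ω k) := by
  unfold pivotCorrection
  fun_prop

theorem pivotCorrection_mem_Ioc (hμ : 0 ≤ μ) (hω : 1 ≤ ω) (hk : 0 < k) (hμk : μ < k) (t : ℝ) :
    pivotCorrection μ ω k t ∈ Ioc 0 (4 / k) := by
  have h1 : μ / (ω * k ^ 2) < 1 / k := by
    rw [div_lt_div_iff₀ (by positivity) hk]
    nlinarith [mul_pos hk hk, mul_lt_mul_of_pos_right hμk hk]
  have h0 : 0 ≤ μ / (ω * k ^ 2) := by positivity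
  have h2 : 0 < 1 / k := by positivity
  have e2 : 2 / k = 2 * (1 / k) := by ring
  have e4 : 4 / k = 4 * (1 / k) := by ring
  have hs := mul_le_mul_of_nonneg_left (sin_le_one (ω * k * t)) h2.le
  have hs' := mul_le_mul_of_nonneg_left (neg_one_le_sin (ω * k * t)) h2.le
  have hc := mul_le_mul_of_nonneg_left (cos_le_one (ω * k * t)) h0
  have hc' := mul_le_mul_of_nonneg_left (neg_one_le_cos (ω * k * t)) h0
  constructor <;> unfold pivotCorrection <;> rw [e2] <;> linarith

/-- The corrected horizontal positions are pushed outwards once `k` is large. -/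
theorem abs_mul_sin_pivotCorrection_le {H η : ℝ} (hμ : 0 ≤ μ) (hω : 1 ≤ ω)
    (hk : 8 + 8 * ω ^ 2 + μ ^ 2 + 4 * H < k) (hη : |η| ≤ H) (t : ℝ) :
    |η * sin (pivotCorrection μ ω k t)| ≤
      deriv (deriv (pivotCorrection μ ω k)) t + μ * deriv (pivotCorrection μ ω k) t
        + (1 + -(ω ^ 2 * k * sin (ω * k * t))) * cos (pivotCorrection μ ω k t) := by
  have hH : 0 ≤ H := (abs_nonneg η).trans hη
  have hk1 : 1 ≤ k := by nlinarith [sq_nonneg ω, sq_nonneg μ]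
  have hk0 : 0 < k := by linarith
  have hμk : μ < k := by nlinarith [sq_nonneg ω, sq_nonneg (μ - 1)]
  obtain ⟨hd0, hd4⟩ := pivotCorrection_mem_Ioc hμ hω hk0 hμk t
  rw [deriv_deriv_pivotCorrection (by positivity) hk0.ne',
    deriv_pivotCorrection (by positivity) hk0.ne']
  set d := pivotCorrection μ ω k t
  set s := sin (ω * k * t)
  set c := cos (ω * k * t)
  have hs : -1 ≤ s := neg_one_le_sin _
  obtain ⟨r, hr⟩ : ∃ r, r = 1 / k := ⟨_, rfl⟩
  have hrk : r * k = 1 := by rw [hr]; field_simp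
  have hr0 : 0 < r := by rw [hr]; positivity
  have hr1 : r ≤ 1 := by rw [hr, div_le_one hk0]; exact hk1
  have hd : d ≤ 4 * r := by rw [hr]; linarith [show 4 / k = 4 * (1 / k) by ring]
  have hd2 : d ^ 2 ≤ 16 * r ^ 2 := by nlinarith
  have hcos : 1 - cos d ≤ 8 * r ^ 2 := by linarith [one_sub_sq_div_two_le_cos (x := d)]
  have hcos0 : 0 ≤ 1 - cos d := by linarith [cos_le_one d]
  have hleft : |η * sin d| ≤ H * (4 * r) := by
    rw [abs_mul]
    refine mul_le_mul hη (abs_sin_le_abs.trans ?_) (abs_nonneg _) hH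
    rwa [abs_of_pos hd0]
  have hsmall : (8 + 8 * ω ^ 2 + μ ^ 2 + 4 * H) * r ≤ 1 := by
    rw [← hrk, mul_comm r]
    exact mul_le_mul_of_nonneg_right hk.le hr0.le
  have hfast : -(8 * ω ^ 2 * r) ≤ (1 - cos d) * (ω ^ 2 * k) * s := by
    have h1 : (1 - cos d) * (ω ^ 2 * k) ≤ 8 * r ^ 2 * (ω ^ 2 * k) := by gcongr
    have h2 : 8 * r ^ 2 * (ω ^ 2 * k) = 8 * ω ^ 2 * r := by
      linear_combination 8 * ω ^ 2 * r * hrk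
    have h3 : 0 ≤ (1 - cos d) * (ω ^ 2 * k) := by positivity
    nlinarith
  have hfric : -(μ ^ 2 * r) ≤ μ ^ 2 * r * s := by
    nlinarith [mul_nonneg (sq_nonneg μ) hr0.le]
  have hexpand : ω ^ 2 * k * s + μ * ω * c + μ * (-(ω * c) + μ / k * s) +
      (1 + -(ω ^ 2 * k * s)) * cos d =
      cos d + (1 - cos d) * (ω ^ 2 * k) * s + μ ^ 2 * r * s := by
    rw [hr]
    ring
  rw [hexpand]
  nlinarith

theorem monotone_mul_sin_add_mul_cos_add_mul {p q Λ : ℝ} (h : |p| + |q| ≤ Λ) :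
    Monotone fun x => p * sin x + q * cos x + Λ * x := by
  have hd : ∀ x, HasDerivAt (fun x => p * sin x + q * cos x + Λ * x)
      (p * cos x + q * (-sin x) + Λ * 1) x := fun x =>
    (((hasDerivAt_sin x).const_mul p).add ((hasDerivAt_cos x).const_mul q)).add
      ((hasDerivAt_id x).const_mul Λ)
  refine monotone_of_deriv_nonneg (fun x => (hd x).differentiableAt) fun x => ?_
  rw [(hd x).deriv]
  have h1 : |p * cos x| ≤ |p| := by
    rw [abs_mul]
    exact mul_le_of_le_one_right (abs_nonneg p) (abs_cos_le_one x)
  have h2 : |q * -sin x| ≤ |q| := by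
    rw [abs_mul, abs_neg]
    exact mul_le_of_le_one_right (abs_nonneg q) (abs_sin_le_one x)
  linarith [neg_le_of_abs_le h1, neg_le_of_abs_le h2]

end KapitzaWhitney

/-- The Kapitza–Whitney pendulum `ẍ + μẋ + (1 + f̈(t)) sin x + h(t) cos x = 0`
with pivot law `f(t) = (1/k) sin(ωkt)`: for any smooth `2π`-periodic horizontal
force `h` there exists `K` such that for every natural `k > K` the equation
admits a `2π`-periodic smooth solution never leaving `(π/2, 3π/2)`. -/
theorem kapitza_whitney_equation_periodic_solution_without_falls
    (μ : ℝ) (hμ : 0 ≤ μ) (ω : ℕ) (hω : 0 < ω)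
    (h : ℝ → ℝ) (hh : ContDiff ℝ (⊤ : ℕ∞) h)
    (hper : Function.Periodic h (2 * π)) :
    ∃ K : ℕ, ∀ k : ℕ, k > K →
      ∃ x : ℝ → ℝ,
        ContDiff ℝ (⊤ : ℕ∞) x ∧ Function.Periodic x (2 * π) ∧
        (∀ t : ℝ,
          deriv (deriv x) t + μ * deriv x t
            + (1 + deriv (deriv (fun s : ℝ =>
                (1 / (k : ℝ)) * sin ((ω : ℝ) * (k : ℝ) * s))) t) * sin (x t)
            + h t * cos (x t) = 0) ∧
        (∀ t : ℝ, x t ∈ Set.Ioo (π / 2) (3 * π / 2)) := by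
  obtain ⟨-, H, hH⟩ := IsBoundedMeasurable.of_continuous_of_periodic two_pi_pos.ne'
    hh.continuous hper
  have hH0 : 0 ≤ H := (abs_nonneg _).trans (hH 0)
  have hω1 : (1 : ℝ) ≤ ω := by exact_mod_cast hω
  refine ⟨⌈8 + 8 * (ω : ℝ) ^ 2 + μ ^ 2 + 4 * H⌉₊, fun k hk => ?_⟩
  have hK : 8 + 8 * (ω : ℝ) ^ 2 + μ ^ 2 + 4 * H < k := Nat.lt_of_ceil_lt hk
  have hk8 : (8 : ℝ) < k := by nlinarith [sq_nonneg (ω : ℝ), sq_nonneg μ]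
  have hk0 : (0 : ℝ) < k := by linarith
  have hμk : μ < k := by nlinarith [sq_nonneg (ω : ℝ), sq_nonneg (μ - 1)]
  rw [deriv_deriv_pivot hk0.ne']
  have hphase : ∀ t : ℝ, (ω : ℝ) * k * (t + 2 * π) = ω * k * t + (ω * k : ℕ) * (2 * π) := by
    intro t
    push_cast
    ring
  have hdT : Function.Periodic (pivotCorrection μ ω k) (2 * π) := fun t => by
    simp only [pivotCorrection, hphase, sin_add_nat_mul_two_pi, cos_add_nat_mul_two_pi]
  have hd := pivotCorrection_mem_Ioc hμ hω1 hk0 hμk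
  have hd_le : ∀ t, pivotCorrection μ ω k t ≤ 1 := fun t =>
    (hd t).2.trans ((div_le_one hk0).2 (by linarith))
  have hout := fun t => abs_le.1 (abs_mul_sin_pivotCorrection_le hμ hω1 hK (hH t) t)
  have hhc := hh.continuous
  obtain ⟨u, v, huT, hbd, hu, hv⟩ := exists_periodic_solution_between two_pi_pos.ne' hμ
    (Λ := 1 + (ω : ℝ) ^ 2 * k + H)
    (g := fun t x => (1 + -((ω : ℝ) ^ 2 * k * sin (ω * k * t))) * sin x + h t * cos x)
    (α := fun t => π / 2 + pivotCorrection μ ω k t)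
    (β := fun t => 3 * π / 2 - pivotCorrection μ ω k t)
    (by fun_prop)
    (fun x t => by simp only [hphase, sin_add_nat_mul_two_pi, hper t])
    (fun t => monotone_mul_sin_add_mul_cos_add_mul (by
      refine add_le_add ((abs_add_le _ _).trans (add_le_add abs_one.le ?_)) (hH t)
      rw [abs_neg, abs_mul, abs_of_nonneg (by positivity : 0 ≤ (ω : ℝ) ^ 2 * k)]
      exact mul_le_of_le_one_right (by positivity) (abs_sin_le_one _)))
    (contDiff_const.add contDiff_pivotCorrection) (contDiff_const.sub contDiff_pivotCorrection)
    (fun t => by simp only [hdT t]) (fun t => by simp only [hdT t])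
    (fun t => by linarith [hd_le t, pi_gt_three])
    (fun t => by
      have e1 : sin (π / 2 + pivotCorrection μ ω k t) = cos (pivotCorrection μ ω k t) := by
        rw [add_comm, sin_add_pi_div_two]
      have e2 : cos (π / 2 + pivotCorrection μ ω k t) = -sin (pivotCorrection μ ω k t) := by
        rw [add_comm, cos_add_pi_div_two]
      simp only [deriv_const_add', e1, e2]
      linarith [(hout t).2])
    (fun t => by
      have e0 : 3 * π / 2 - pivotCorrection μ ω k t =
          (π / 2 - pivotCorrection μ ω k t) + π := by ring
      have e1 : sin (3 * π / 2 - pivotCorrection μ ω k t) = -cos (pivotCorrection μ ω k t) := by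
        rw [e0, sin_add_pi, sin_pi_div_two_sub]
      have e2 : cos (3 * π / 2 - pivotCorrection μ ω k t) = -sin (pivotCorrection μ ω k t) := by
        rw [e0, cos_add_pi, cos_pi_div_two_sub]
      have e3 : deriv (fun t => 3 * π / 2 - pivotCorrection μ ω k t) =
          fun t => -deriv (pivotCorrection μ ω k) t := funext fun t => deriv_const_sub _
      simp only [e3, deriv.fun_neg, e1, e2]
      linarith [(hout t).1])
  refine ⟨u, contDiff_of_hasDerivAt_of_hasDerivAt (F := fun t x y => -(μ * y) -
    ((1 + -((ω : ℝ) ^ 2 * k * sin (ω * k * t))) * sin x + h t * cos x)) (by fun_prop) hu hv,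
    huT, fun t => ?_, fun t => ⟨?_, ?_⟩⟩
  · rw [funext fun t => (hu t).deriv, (hv t).deriv]
    ring
  · linarith [(hbd t).1, (hd t).1]
  · linarith [(hbd t).2, (hd t).1]
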